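/- For every integer n ≥ 1, let T_n be the tree obtained from the star K_{1,n+1} by attaching n pendant edges to each of its n+1 leaves. Then A_b(T_n) = n+2 and A(T_n) = 2; consequently A_b(T_n) − A(T_n) = n, so the difference between the acyclic b-chromatic number and the acyclic chromatic number of a graph can be arbitrarily large. -/

import Mathlib

open SimpleGraph

namespace AcyclicB

variable {V : Type*}

/-- `c` is a proper vertex coloring of `G`. -/
def Proper (G : SimpleGraph V) (c : V → ℕ) : Prop :=
  ∀ ⦃u v : V⦄, G.Adj u v → c u ≠ c v

/-- `c` is an acyclic (proper) coloring of `G`: the subgraph induced by the union of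
any two color classes is a forest. -/
def IsAcyclicColoring (G : SimpleGraph V) (c : V → ℕ) : Prop :=
  Proper G c ∧ ∀ i j : ℕ, (G.induce {v | c v = i ∨ c v = j}).IsAcyclic

/-- The closed neighborhood of `v` in `G`. -/
def closedNbhd (G : SimpleGraph V) (v : V) : Set V :=
  insert v (G.neighborSet v)

/-- `c'` is obtained from the acyclic coloring `c` by an acyclic recoloring step removing
one color `i`: every vertex of a color different from `i` keeps its color, and every vertex
of color `i` receives a color (among the colors of `c`, different from `i`) that is absent
from its closed neighborhood; the resulting coloring is again acyclic. -/
def RecolorStep (G : SimpleGraph V) (c' c : V → ℕ) : Prop :=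
  IsAcyclicColoring G c ∧ IsAcyclicColoring G c' ∧
  ∃ i ∈ Set.range c,
    (∀ v, c v ≠ i → c' v = c v) ∧
    (∀ v, c v = i → c' v ∈ Set.range c ∧ c' v ≠ i ∧
      ∀ u ∈ closedNbhd G v, c u ≠ c' v)

/-- The strict partial order `≺ₐ` on acyclic colorings: the transitive closure of the
acyclic recoloring step relation. -/
def StrictOrder (G : SimpleGraph V) : (V → ℕ) → (V → ℕ) → Prop :=
  Relation.TransGen (RecolorStep G)

/-- `c` is a minimal element of `≺ₐ`: an acyclic coloring admitting no acyclic recoloring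
step. -/
def IsMinimal (G : SimpleGraph V) (c : V → ℕ) : Prop :=
  IsAcyclicColoring G c ∧ ∀ c', ¬ RecolorStep G c' c

/-- The number of colors used by `c`. -/
def ncolors [Fintype V] (c : V → ℕ) : ℕ :=
  (Finset.univ.image c).card

/-- The acyclic b-chromatic number of `G`: the maximum number of colors used by a minimal
element of `≺ₐ`. -/
noncomputable def Ab [Fintype V] (G : SimpleGraph V) : ℕ :=
  sSup { k | ∃ c : V → ℕ, IsMinimal G c ∧ ncolors c = k }

/-- The acyclic chromatic number of `G`: the minimum number of colors in an acyclic
proper coloring. -/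
noncomputable def Achrom [Fintype V] (G : SimpleGraph V) : ℕ :=
  sInf { k | ∃ c : V → ℕ, IsAcyclicColoring G c ∧ ncolors c = k }

/-- The join of two graphs: disjoint copies of `G` and `H` together with all edges
between them. -/
def join {α β : Type*} (G : SimpleGraph α) (H : SimpleGraph β) : SimpleGraph (α ⊕ β) where
  Adj x y :=
    match x, y with
    | Sum.inl a, Sum.inl a' => G.Adj a a'
    | Sum.inr b, Sum.inr b' => H.Adj b b'
    | Sum.inl _, Sum.inr _ => True
    | Sum.inr _, Sum.inl _ => True
  symm := by
    refine ⟨?_⟩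
    rintro (a | b) (a' | b') h
    · exact SimpleGraph.Adj.symm (G := G) h
    · trivial
    · trivial
    · exact SimpleGraph.Adj.symm (G := H) h
  loopless := by
    refine ⟨?_⟩
    rintro (a | b) h
    · exact G.loopless.irrefl a h
    · exact H.loopless.irrefl b h

end AcyclicB

namespace AcyclicB

/-- The tree `Tₙ` obtained from the star `K_{1,n+1}` by attaching `n` pendant edges to
each of its `n + 1` leaves. The vertex `none` is the center, `some (i, none)` is the
`i`-th leaf of the star, and `some (i, some j)` is the `j`-th pendant vertex attached to
the `i`-th leaf. -/
def starTree (n : ℕ) : SimpleGraph (Option (Fin (n + 1) × Option (Fin n))) :=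
  SimpleGraph.fromRel (fun x y =>
    (x = none ∧ ∃ i, y = some (i, none)) ∨
    (∃ i j, x = some (i, none) ∧ y = some (i, some j)))

variable {V : Type*}

/-- `v` is a b-vertex of `c`: its closed neighborhood meets every color of `c`. -/
def IsBVertex (G : SimpleGraph V) (c : V → ℕ) (v : V) : Prop :=
  ∀ k ∈ Set.range c, ∃ u ∈ closedNbhd G v, c u = k

/-- In a forest every proper coloring is acyclic. -/
theorem Proper.isAcyclicColoring {G : SimpleGraph V} {c : V → ℕ} (hc : Proper G c)
    (hG : G.IsAcyclic) : IsAcyclicColoring G c :=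
  ⟨hc, fun _ _ => hG.induce _⟩

/-- An acyclic coloring in which every color class has a b-vertex is minimal. -/
theorem isMinimal_of_forall_exists_isBVertex {G : SimpleGraph V} {c : V → ℕ}
    (hc : IsAcyclicColoring G c) (h : ∀ i ∈ Set.range c, ∃ v, c v = i ∧ IsBVertex G c v) :
    IsMinimal G c := by
  refine ⟨hc, ?_⟩
  rintro c' ⟨-, -, i, hi, -, hrec⟩
  obtain ⟨v, hv, hb⟩ := h i hi
  obtain ⟨hr, -, habs⟩ := hrec v hv
  obtain ⟨u, hu, huc⟩ := hb _ hr
  exact habs u hu huc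

/-- In a forest, every color of a minimal coloring has a b-vertex. -/
theorem IsMinimal.exists_isBVertex {G : SimpleGraph V} {c : V → ℕ} (hc : IsMinimal G c)
    (hG : G.IsAcyclic) {i : ℕ} (hi : i ∈ Set.range c) : ∃ v, c v = i ∧ IsBVertex G c v := by
  classical
  by_contra! hno
  have hex : ∀ v, ∃ k, c v = i → k ∈ Set.range c ∧ ∀ u ∈ closedNbhd G v, c u ≠ k := by
    intro v
    by_cases hv : c v = i
    · have := hno v hv
      simp only [IsBVertex, not_forall, not_exists, not_and] at this
      obtain ⟨k, hk, hku⟩ := this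
      exact ⟨k, fun _ => ⟨hk, hku⟩⟩
    · exact ⟨0, fun h => absurd h hv⟩
  choose f hf using hex
  refine hc.2 (fun v => if c v = i then f v else c v) ⟨hc.1, Proper.isAcyclicColoring ?_ hG,
    i, hi, fun v hv => by simp [hv], fun v hv => ?_⟩
  · intro u v huv
    have hne := hc.1.1 huv
    by_cases hu : c u = i
    · have hv : c v ≠ i := fun h => hne (hu.trans h.symm)
      simpa [hu, hv] using ((hf u hu).2 v (Set.mem_insert_of_mem _ huv)).symm
    · by_cases hv : c v = i
      · simpa [hu, hv] using (hf v hv).2 u (Set.mem_insert_of_mem _ huv.symm)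
      · simpa [hu, hv] using hne
  · have hself := (hf v hv).2 v (Set.mem_insert _ _)
    simp only [hv, if_true]
    exact ⟨(hf v hv).1, fun h => hself (hv.trans h.symm), (hf v hv).2⟩

/-- An edge is a bridge as soon as some vertex set separates its ends and is respected by all
other edges. -/
theorem isBridge_of_separating {G : SimpleGraph V} {u v : V} (P : V → Prop)
    (hu : ¬ P u) (hv : P v) (h : ∀ x y, G.Adj x y → s(x, y) ≠ s(u, v) → (P x ↔ P y)) :
    G.IsBridge s(u, v) := by
  rw [isBridge_iff]
  have key : ∀ x y, (G.deleteEdges {s(u, v)}).Reachable x y → (P x ↔ P y) := by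
    rintro x y ⟨w⟩
    induction w with
    | nil => rfl
    | cons hadj _ ih =>
      rw [deleteEdges_adj] at hadj
      exact (h _ _ hadj.1 hadj.2).trans ih
  exact fun hr => hu ((key u v hr).2 hv)

theorem starTree_adj_center (n : ℕ) (i : Fin (n + 1)) :
    (starTree n).Adj none (some (i, none)) := by
  simp [starTree]

theorem starTree_adj_pendant (n : ℕ) (i : Fin (n + 1)) (j : Fin n) :
    (starTree n).Adj (some (i, none)) (some (i, some j)) := by
  simp [starTree]

/-- Every edge of `starTree n` is a center edge or a pendant edge, up to orientation. -/
theorem starTree_adj_cases {n : ℕ} {x y : Option (Fin (n + 1) × Option (Fin n))}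
    (h : (starTree n).Adj x y) :
    (∃ i, (x = none ∧ y = some (i, none)) ∨ (y = none ∧ x = some (i, none))) ∨
    ∃ i j, (x = some (i, none) ∧ y = some (i, some j)) ∨
      (y = some (i, none) ∧ x = some (i, some j)) := by
  obtain ⟨-, (⟨hx, i, hy⟩ | ⟨i, j, hx, hy⟩) | (⟨hx, i, hy⟩ | ⟨i, j, hx, hy⟩)⟩ := h
  · exact Or.inl ⟨i, Or.inl ⟨hx, hy⟩⟩
  · exact Or.inr ⟨i, j, Or.inl ⟨hx, hy⟩⟩
  · exact Or.inl ⟨i, Or.inr ⟨hx, hy⟩⟩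
  · exact Or.inr ⟨i, j, Or.inr ⟨hx, hy⟩⟩

theorem starTree_isAcyclic (n : ℕ) : (starTree n).IsAcyclic := by
  have hcenter (i : Fin (n + 1)) : (starTree n).IsBridge s(none, some (i, none)) := by
    refine isBridge_of_separating (fun x => ∃ o, x = some (i, o)) (by simp) (by simp) ?_
    intro x y hxy hne
    obtain ⟨k, ⟨rfl, rfl⟩ | ⟨rfl, rfl⟩⟩ | ⟨k, j, ⟨rfl, rfl⟩ | ⟨rfl, rfl⟩⟩ :=
      starTree_adj_cases hxy <;> simp_all
  have hpendant (i : Fin (n + 1)) (j : Fin n) :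
      (starTree n).IsBridge s(some (i, none), some (i, some j)) := by
    refine isBridge_of_separating (fun x => x = some (i, some j)) (by simp) (by simp) ?_
    intro x y hxy hne
    obtain ⟨k, ⟨rfl, rfl⟩ | ⟨rfl, rfl⟩⟩ | ⟨k, l, ⟨rfl, rfl⟩ | ⟨rfl, rfl⟩⟩ :=
      starTree_adj_cases hxy <;> simp_all
  rw [isAcyclic_iff_forall_adj_isBridge]
  intro x y hxy
  obtain ⟨k, ⟨rfl, rfl⟩ | ⟨rfl, rfl⟩⟩ | ⟨k, j, ⟨rfl, rfl⟩ | ⟨rfl, rfl⟩⟩ :=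
    starTree_adj_cases hxy
  · exact hcenter k
  · exact Sym2.eq_swap ▸ hcenter k
  · exact hpendant k j
  · exact Sym2.eq_swap ▸ hpendant k j

/-- Closed neighborhoods in `starTree n` have at most `n + 2` vertices. -/
theorem starTree_closedNbhd_subset (n : ℕ) (v : Option (Fin (n + 1) × Option (Fin n))) :
    ∃ f : Option (Option (Fin n)) → Option (Fin (n + 1) × Option (Fin n)),
      closedNbhd (starTree n) v ⊆ Set.range f := by
  rcases v with _ | ⟨i, _ | j⟩
  · refine ⟨fun o => (o.map finSuccEquivLast.symm).map fun i => (i, none), ?_⟩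
    rintro u (rfl | hu)
    · exact ⟨none, rfl⟩
    · obtain ⟨k, h | h⟩ | ⟨k, l, h | h⟩ := starTree_adj_cases hu <;> simp at h
      exact ⟨some (finSuccEquivLast k), by simp [h]⟩
  · refine ⟨fun o => o.elim none fun p => some (i, p), ?_⟩
    rintro u (rfl | hu)
    · exact ⟨some none, rfl⟩
    · obtain ⟨k, h | h⟩ | ⟨k, l, h | h⟩ := starTree_adj_cases hu <;> simp at h
      · exact ⟨none, by simp [h]⟩
      · exact ⟨some (some l), by simp [h]⟩
  · refine ⟨fun o => o.elim (some (i, some j)) fun _ => some (i, none), ?_⟩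
    rintro u (rfl | hu)
    · exact ⟨none, rfl⟩
    · obtain ⟨k, h | h⟩ | ⟨k, l, h | h⟩ := starTree_adj_cases hu <;> simp at h
      exact ⟨some none, by simp [h]⟩

theorem ncolors_le_of_isMinimal_starTree {n : ℕ}
    {c : Option (Fin (n + 1) × Option (Fin n)) → ℕ} (hc : IsMinimal (starTree n) c) :
    ncolors c ≤ n + 2 := by
  obtain ⟨v, -, hb⟩ := hc.exists_isBVertex (starTree_isAcyclic n) ⟨none, rfl⟩
  obtain ⟨f, hf⟩ := starTree_closedNbhd_subset n v
  have hsub : Finset.univ.image c ⊆ Finset.univ.image (c ∘ f) := by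
    intro k hk
    obtain ⟨u, hu, rfl⟩ := hb k (by simpa using hk)
    obtain ⟨o, rfl⟩ := hf hu
    simp
  calc ncolors c ≤ (Finset.univ.image (c ∘ f)).card := Finset.card_le_card hsub
    _ ≤ (Finset.univ : Finset (Option (Option (Fin n)))).card := Finset.card_image_le
    _ = n + 2 := by simp

/-- A coloring of `starTree n` with `n + 2` colors in which the center and its neighbors are
b-vertices of pairwise distinct colors. -/
def starTreeBColoring (n : ℕ) : Option (Fin (n + 1) × Option (Fin n)) → ℕ
  | none => 0
  | some (i, none) => i + 1
  | some (i, some j) => i.succAbove j + 1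

theorem mem_range_starTreeBColoring {n k : ℕ} :
    k ∈ Set.range (starTreeBColoring n) ↔ k < n + 2 := by
  constructor
  · rintro ⟨_ | ⟨i, _ | j⟩, rfl⟩ <;> simp only [starTreeBColoring] <;> omega
  · intro hk
    rcases k with _ | k
    · exact ⟨none, rfl⟩
    · exact ⟨some (⟨k, by omega⟩, none), rfl⟩

theorem starTreeBColoring_isAcyclicColoring (n : ℕ) :
    IsAcyclicColoring (starTree n) (starTreeBColoring n) := by
  refine Proper.isAcyclicColoring ?_ (starTree_isAcyclic n)
  intro x y hxy
  obtain ⟨k, ⟨rfl, rfl⟩ | ⟨rfl, rfl⟩⟩ | ⟨k, j, ⟨rfl, rfl⟩ | ⟨rfl, rfl⟩⟩ :=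
    starTree_adj_cases hxy <;>
  simp [starTreeBColoring, Fin.val_inj, Fin.succAbove_ne, (Fin.succAbove_ne _ _).symm]

theorem starTreeBColoring_isMinimal (n : ℕ) :
    IsMinimal (starTree n) (starTreeBColoring n) := by
  refine isMinimal_of_forall_exists_isBVertex (starTreeBColoring_isAcyclicColoring n) ?_
  intro i hi
  rw [mem_range_starTreeBColoring] at hi
  rcases i with _ | i
  · refine ⟨none, rfl, fun k hk => ?_⟩
    rw [mem_range_starTreeBColoring] at hk
    rcases k with _ | k
    · exact ⟨none, Set.mem_insert _ _, rfl⟩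
    · exact ⟨_, Set.mem_insert_of_mem _ (starTree_adj_center n ⟨k, by omega⟩), rfl⟩
  · refine ⟨some (⟨i, by omega⟩, none), rfl, fun k hk => ?_⟩
    rw [mem_range_starTreeBColoring] at hk
    rcases k with _ | k
    · exact ⟨none, Set.mem_insert_of_mem _ (starTree_adj_center n _).symm, rfl⟩
    · by_cases hki : k = i
      · subst hki
        exact ⟨_, Set.mem_insert _ _, rfl⟩
      · obtain ⟨j, hj⟩ := Fin.exists_succAbove_eq
          (x := (⟨k, by omega⟩ : Fin (n + 1))) (y := ⟨i, by omega⟩) (by simpa using hki)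
        exact ⟨_, Set.mem_insert_of_mem _ (starTree_adj_pendant n _ j),
          by simp [starTreeBColoring, hj]⟩

theorem ncolors_starTreeBColoring (n : ℕ) : ncolors (starTreeBColoring n) = n + 2 := by
  have : Finset.univ.image (starTreeBColoring n) = Finset.range (n + 2) := by
    ext k
    simpa using mem_range_starTreeBColoring (n := n) (k := k)
  rw [ncolors, this, Finset.card_range]

theorem Ab_starTree (n : ℕ) : Ab (starTree n) = n + 2 := by
  refine IsGreatest.csSup_eq
    ⟨⟨_, starTreeBColoring_isMinimal n, ncolors_starTreeBColoring n⟩, ?_⟩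
  rintro k ⟨c, hc, rfl⟩
  exact ncolors_le_of_isMinimal_starTree hc

/-- The proper coloring of `starTree n` by its two bipartition classes. -/
def starTreeTwoColoring (n : ℕ) : Option (Fin (n + 1) × Option (Fin n)) → ℕ
  | some (_, none) => 1
  | _ => 0

theorem two_le_ncolors_of_adj [Fintype V] {G : SimpleGraph V} {c : V → ℕ} (hc : Proper G c)
    {u v : V} (h : G.Adj u v) : 2 ≤ ncolors c :=
  Finset.one_lt_card.2 ⟨c u, by simp, c v, by simp, hc h⟩

theorem starTreeTwoColoring_isAcyclicColoring (n : ℕ) :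
    IsAcyclicColoring (starTree n) (starTreeTwoColoring n) := by
  refine Proper.isAcyclicColoring ?_ (starTree_isAcyclic n)
  intro x y hxy
  obtain ⟨k, ⟨rfl, rfl⟩ | ⟨rfl, rfl⟩⟩ | ⟨k, j, ⟨rfl, rfl⟩ | ⟨rfl, rfl⟩⟩ :=
    starTree_adj_cases hxy <;>
  simp [starTreeTwoColoring]

theorem ncolors_starTreeTwoColoring (n : ℕ) : ncolors (starTreeTwoColoring n) = 2 := by
  refine le_antisymm ?_ (two_le_ncolors_of_adj
    (starTreeTwoColoring_isAcyclicColoring n).1 (starTree_adj_center n 0))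
  have : Finset.univ.image (starTreeTwoColoring n) ⊆ Finset.range 2 := by
    intro k hk
    obtain ⟨x, -, rfl⟩ := Finset.mem_image.1 hk
    rcases x with _ | ⟨i, _ | j⟩ <;> simp [starTreeTwoColoring]
  simpa [ncolors] using Finset.card_le_card this

theorem Achrom_starTree (n : ℕ) : Achrom (starTree n) = 2 := by
  refine IsLeast.csInf_eq
    ⟨⟨_, starTreeTwoColoring_isAcyclicColoring n, ncolors_starTreeTwoColoring n⟩, ?_⟩
  rintro k ⟨c, hc, rfl⟩
  exact two_le_ncolors_of_adj hc.1 (starTree_adj_center n 0)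

/-- For every `n ≥ 1`, `A_b(Tₙ) = n + 2` and `A(Tₙ) = 2`, hence
`A_b(Tₙ) − A(Tₙ) = n`: the difference between the acyclic b-chromatic number and the
acyclic chromatic number can be arbitrarily large. -/
theorem ab_sub_achrom_unbounded (n : ℕ) (hn : 1 ≤ n) :
    Ab (starTree n) = n + 2 ∧ Achrom (starTree n) = 2 ∧
      Ab (starTree n) - Achrom (starTree n) = n := by
  simp [Ab_starTree, Achrom_starTree]

end AcyclicB
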